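/- Let 𝔄 be a unital complex Banach algebra and let H : ℝ → 𝔄 be continuous. For t ≥ 0 let U(t) = 1 + ∑_{n=1}^∞ (−i)ⁿ • ∫_{Δₙ(t)} H(s (n−1)) * ⋯ * H(s 0) ds be the time-ordered exponential series (which converges absolutely). Then U(0) = 1 and for every t > 0 the map U has a derivative at t equal to (−i) • (H(t) * U(t)); that is, U solves the evolution equation dU/dt = −i H(t) U(t) with initial condition U(0) = 1. -/

import Mathlib

open MeasureTheory

/-- The open simplex `Δₙ(t) = {s | 0 < s 0 < s 1 < ⋯ < s (n-1) < t}` in `Fin n → ℝ`. -/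
def openSimplex (n : ℕ) (t : ℝ) : Set (Fin n → ℝ) :=
  {s : Fin n → ℝ | (∀ i j : Fin n, i < j → s i < s j) ∧ ∀ i : Fin n, 0 < s i ∧ s i < t}

/-- The chronologically (decreasing time) ordered product
`H(s (n-1)) * H(s (n-2)) * ⋯ * H(s 0)`, later times to the left. -/
def chronoProd {𝔄 : Type*} [Monoid 𝔄] (H : ℝ → 𝔄) (n : ℕ) (s : Fin n → ℝ) : 𝔄 :=
  ((List.ofFn fun i : Fin n => H (s i)).reverse).prod

/-- The time-ordered exponential
`U(t) = 1 + ∑_{n≥1} (−i)ⁿ • ∫_{Δₙ(t)} H(s (n-1)) ⋯ H(s 0) ds`. -/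
noncomputable def chronoExp {𝔄 : Type*} [NormedRing 𝔄] [NormedAlgebra ℂ 𝔄]
    [CompleteSpace 𝔄] (H : ℝ → 𝔄) (t : ℝ) : 𝔄 :=
  1 + ∑' n : ℕ, ((-Complex.I) ^ (n + 1)) •
    ∫ s in openSimplex (n + 1) t, chronoProd H (n + 1) s
      ∂(Measure.pi fun _ : Fin (n + 1) => (volume : Measure ℝ))

theorem measurableSet_openSimplex (n : ℕ) (t : ℝ) : MeasurableSet (openSimplex n t) := by
  have h : openSimplex n t =
      (⋂ i : Fin n, ⋂ j : Fin n, ⋂ _ : i < j, {s | s i < s j}) ∩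
        ⋂ i : Fin n, {s | 0 < s i} ∩ {s | s i < t} := by
    ext s
    simp [openSimplex]
  rw [h]
  refine .inter (.iInter fun i => .iInter fun j => .iInter fun _ => ?_)
    (.iInter fun i => .inter ?_ ?_)
  · exact measurableSet_lt (measurable_pi_apply i) (measurable_pi_apply j)
  · exact measurableSet_lt measurable_const (measurable_pi_apply i)
  · exact measurableSet_lt (measurable_pi_apply i) measurable_const

theorem openSimplex_succ_eq_empty (n : ℕ) {t : ℝ} (ht : t ≤ 0) : openSimplex (n + 1) t = ∅ := by
  ext s
  simp only [Set.mem_empty_iff_false, iff_false]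
  intro hs
  have := hs.2 0
  linarith

theorem openSimplex_zero (t : ℝ) : openSimplex 0 t = Set.univ := by
  ext s
  simp [openSimplex]

/-- Splitting off the latest time: a point of `Δₙ₊₁(t)` is a time in `(0, t)` together with
a point of the simplex up to that time. -/
theorem mem_openSimplex_succ {n : ℕ} {t : ℝ} {s : Fin (n + 1) → ℝ} :
    s ∈ openSimplex (n + 1) t ↔
      s (Fin.last n) ∈ Set.Ioo 0 t ∧ (fun i => s (Fin.castSucc i)) ∈
        openSimplex n (s (Fin.last n)) := by
  simp only [openSimplex, Set.mem_ofPred_eq, Set.mem_Ioo, Fin.forall_fin_succ',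
    Fin.castSucc_lt_castSucc_iff, Fin.castSucc_lt_last, lt_irrefl, Fin.not_lt.2 (Fin.le_last _),
    forall_true_left, IsEmpty.forall_iff, implies_true, and_true]
  constructor
  · rintro ⟨h1, h2, h3⟩
    exact ⟨h3, fun i j => (h1 i).1 j, fun i => ⟨(h2 i).1, (h1 i).2⟩⟩
  · rintro ⟨h3, h1, h2⟩
    exact ⟨fun i => ⟨h1 i, (h2 i).2⟩, fun i => ⟨(h2 i).1, (h2 i).2.trans h3.2⟩, h3⟩

theorem chronoProd_succ {M : Type*} [Monoid M] (H : ℝ → M) (n : ℕ) (s : Fin (n + 1) → ℝ) :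
    chronoProd H (n + 1) s =
      H (s (Fin.last n)) * chronoProd H n fun i => s (Fin.castSucc i) := by
  rw [chronoProd, List.ofFn_succ']
  simp [chronoProd]

theorem continuous_chronoProd {M : Type*} [Monoid M] [TopologicalSpace M] [ContinuousMul M]
    {H : ℝ → M} (hH : Continuous H) (n : ℕ) : Continuous (chronoProd H n) := by
  induction n with
  | zero => exact (continuous_const (y := (1 : M))).congr fun s => by simp [chronoProd]
  | succ n ih =>
    simp only [funext (chronoProd_succ H n)]
    fun_prop

theorem integrableOn_chronoProd {𝔄 : Type*} [NormedRing 𝔄] {H : ℝ → 𝔄} (hH : Continuous H)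
    (n : ℕ) (t : ℝ) :
    IntegrableOn (chronoProd H n) (openSimplex n t) (Measure.pi fun _ => (volume : Measure ℝ)) := by
  have hc : IsCompact (Set.univ.pi fun _ : Fin n => Set.Icc 0 t) :=
    isCompact_univ_pi fun _ => isCompact_Icc
  refine ((continuous_chronoProd hH n).continuousOn.integrableOn_compact hc).mono_set ?_
  intro s hs i _
  exact ⟨(hs.2 i).1.le, (hs.2 i).2.le⟩

section

variable {𝔄 : Type*} [NormedRing 𝔄] [NormedAlgebra ℂ 𝔄]

/-- The iterated integrals `Dₙ₊₁(t) = ∫₀ᵗ H(u) Dₙ(u) du`, `D₀ = 1`. -/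
noncomputable def dysonTerm (H : ℝ → 𝔄) : ℕ → ℝ → 𝔄
  | 0, _ => 1
  | n + 1, t => ∫ u in (0 : ℝ)..t, H u * dysonTerm H n u

theorem continuous_dysonTerm {H : ℝ → 𝔄} (hH : Continuous H) (n : ℕ) :
    Continuous (dysonTerm H n) := by
  induction n with
  | zero => exact continuous_const
  | succ n ih =>
    exact intervalIntegral.continuous_primitive
      (fun a b => (hH.mul ih).intervalIntegrable a b) 0

theorem hasDerivAt_dysonTerm_succ [CompleteSpace 𝔄] {H : ℝ → 𝔄} (hH : Continuous H)
    (n : ℕ) (t : ℝ) :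
    HasDerivAt (dysonTerm H (n + 1)) (H t * dysonTerm H n t) t :=
  ((hH.mul (continuous_dysonTerm hH n)).integral_hasStrictDerivAt 0 t).hasDerivAt

theorem norm_dysonTerm_le {H : ℝ → 𝔄} {C T : ℝ}
    (hC : ∀ u ∈ Set.Icc 0 T, ‖H u‖ ≤ C) (n : ℕ) {t : ℝ} (ht : t ∈ Set.Icc 0 T) :
    ‖dysonTerm H n t‖ ≤ ‖(1 : 𝔄)‖ * ((C * t) ^ n / n.factorial) := by
  induction n generalizing t with
  | zero => simp [dysonTerm]
  | succ n ih =>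
    have hC0 : 0 ≤ C := (norm_nonneg _).trans (hC t ht)
    have hderiv : ∀ u : ℝ, HasDerivAt
        (fun u => ‖(1 : 𝔄)‖ * ((C * u) ^ (n + 1) / (n + 1).factorial))
        (C * (‖(1 : 𝔄)‖ * ((C * u) ^ n / n.factorial))) u := by
      intro u
      have h := ((((hasDerivAt_id u).const_mul C).pow (n + 1)).div_const
        ((n + 1).factorial : ℝ)).const_mul ‖(1 : 𝔄)‖
      refine h.congr_deriv ?_
      have : (n.factorial : ℝ) ≠ 0 := by positivity
      have : (n : ℝ) + 1 ≠ 0 := by positivity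
      simp only [Nat.factorial_succ, id, Nat.add_sub_cancel]
      push_cast
      field_simp
    have hint : ∫ u in (0 : ℝ)..t, C * (‖(1 : 𝔄)‖ * ((C * u) ^ n / n.factorial)) =
        ‖(1 : 𝔄)‖ * ((C * t) ^ (n + 1) / (n + 1).factorial) := by
      rw [intervalIntegral.integral_eq_sub_of_hasDerivAt (fun u _ => hderiv u)
        (Continuous.intervalIntegrable (by fun_prop) _ _)]
      simp
    rw [← hint]
    refine intervalIntegral.norm_integral_le_of_norm_le ht.1 (.of_forall fun u hu => ?_)
      (Continuous.intervalIntegrable (by fun_prop) _ _)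
    have hu' : u ∈ Set.Icc 0 T := ⟨hu.1.le, hu.2.trans ht.2⟩
    exact (norm_mul_le _ _).trans (mul_le_mul (hC u hu') (ih hu') (norm_nonneg _) hC0)

theorem exists_summable_bound {H : ℝ → 𝔄} (hH : Continuous H) (T : ℝ) :
    ∃ b : ℕ → ℝ, Summable b ∧ ∀ n, ∀ t ∈ Set.Icc 0 T,
      ‖H t‖ * ‖dysonTerm H n t‖ ≤ b n ∧ ‖dysonTerm H n t‖ ≤ b n := by
  obtain ⟨C, hC⟩ := isCompact_Icc.exists_bound_of_continuousOn (hH.continuousOn (s := Set.Icc 0 T))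
  refine ⟨fun n => (C + 1) * (‖(1 : 𝔄)‖ * ((C * T) ^ n / n.factorial)),
    ((Real.summable_pow_div_factorial _).mul_left _).mul_left _, fun n t ht => ?_⟩
  have hC0 : 0 ≤ C := (norm_nonneg _).trans (hC t ht)
  have ht0 := ht.1
  have hD : ‖dysonTerm H n t‖ ≤ ‖(1 : 𝔄)‖ * ((C * T) ^ n / n.factorial) := by
    refine (norm_dysonTerm_le hC n ht).trans ?_
    gcongr
    exact ht.2
  constructor
  · exact mul_le_mul ((hC t ht).trans (by linarith)) hD (norm_nonneg _) (by linarith)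
  · refine hD.trans (le_mul_of_one_le_left ((norm_nonneg _).trans hD) (by linarith))

variable [CompleteSpace 𝔄]

theorem summable_dysonTerm {H : ℝ → 𝔄} (hH : Continuous H) {t : ℝ} (ht : 0 ≤ t) :
    Summable fun n : ℕ => (-Complex.I) ^ n • dysonTerm H n t := by
  obtain ⟨b, hb, hbound⟩ := exists_summable_bound hH t
  refine .of_norm_bounded hb fun n => ?_
  simpa [norm_smul] using (hbound n t ⟨ht, le_rfl⟩).2

/-- The integral over the simplex is the iterated integral. -/
theorem setIntegral_openSimplex_chronoProd {H : ℝ → 𝔄} (hH : Continuous H) (n : ℕ) {t : ℝ}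
    (ht : 0 ≤ t) :
    ∫ s in openSimplex n t, chronoProd H n s ∂(Measure.pi fun _ => (volume : Measure ℝ)) =
      dysonTerm H n t := by
  induction n generalizing t with
  | zero => simp [openSimplex_zero, chronoProd, dysonTerm, measureReal_def]
  | succ n ih =>
    let e := MeasurableEquiv.piFinSuccAbove (fun _ : Fin (n + 1) => ℝ) (Fin.last n)
    have he : MeasurePreserving e (Measure.pi fun _ : Fin (n + 1) => (volume : Measure ℝ))
        (volume.prod (Measure.pi fun _ : Fin n => (volume : Measure ℝ))) :=
      measurePreserving_piFinSuccAbove (fun _ : Fin (n + 1) => (volume : Measure ℝ)) (Fin.last n)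
    let P : Set (ℝ × (Fin n → ℝ)) := {p | p.1 ∈ Set.Ioo 0 t ∧ p.2 ∈ openSimplex n p.1}
    let g : ℝ × (Fin n → ℝ) → 𝔄 := fun p => H p.1 * chronoProd H n p.2
    have heP : openSimplex (n + 1) t = e ⁻¹' P := by
      ext s
      simp [mem_openSimplex_succ, e, P, Fin.init_def]
    have hge : chronoProd H (n + 1) = g ∘ e := by
      ext s
      simp [chronoProd_succ, e, g, Fin.init_def]
    have hP : MeasurableSet P := by
      rw [← e.measurableSet_preimage, ← heP]
      exact measurableSet_openSimplex _ _
    have hg : IntegrableOn g P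
        (volume.prod (Measure.pi fun _ : Fin n => (volume : Measure ℝ))) := by
      rw [← he.integrableOn_comp_preimage e.measurableEmbedding, ← heP, ← hge]
      exact integrableOn_chronoProd hH _ _
    have hinner : ∀ u, ∫ s, P.indicator g (u, s) ∂(Measure.pi fun _ => (volume : Measure ℝ)) =
        (Set.Ioo 0 t).indicator (fun u => H u * dysonTerm H n u) u := by
      intro u
      by_cases hu : u ∈ Set.Ioo 0 t
      · have h : (fun s => P.indicator g (u, s)) =
            (openSimplex n u).indicator fun s => H u * chronoProd H n s := by
          ext s
          have hs : (u, s) ∈ P ↔ s ∈ openSimplex n u := and_iff_right hu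
          by_cases h : s ∈ openSimplex n u
          · rw [Set.indicator_of_mem h, Set.indicator_of_mem (hs.2 h)]
          · rw [Set.indicator_of_notMem h, Set.indicator_of_notMem (mt hs.1 h)]
        rw [h, integral_indicator (measurableSet_openSimplex n u), Set.indicator_of_mem hu,
          ← ih hu.1.le, integral_const_mul_of_integrable (integrableOn_chronoProd hH n u)]
      · have h : (fun s => P.indicator g (u, s)) = 0 := by
          ext s
          exact Set.indicator_of_notMem (fun hs => hu hs.1) _
        rw [h, Set.indicator_of_notMem hu]
        simp
    rw [heP, hge]
    simp only [Function.comp_apply]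
    rw [he.setIntegral_preimage_emb e.measurableEmbedding, ← integral_indicator hP,
      integral_prod _ (hg.integrable_indicator hP)]
    simp only [hinner]
    rw [integral_indicator measurableSet_Ioo, dysonTerm, intervalIntegral.integral_of_le ht,
      integral_Ioc_eq_integral_Ioo]

theorem chronoExp_of_nonneg {H : ℝ → 𝔄} (hH : Continuous H) {t : ℝ} (ht : 0 ≤ t) :
    chronoExp H t = 1 + ∑' n : ℕ, (-Complex.I) ^ (n + 1) • dysonTerm H (n + 1) t := by
  simp only [chronoExp, setIntegral_openSimplex_chronoProd hH _ ht]

theorem hasDerivAt_tsum_dysonTerm {H : ℝ → 𝔄} (hH : Continuous H) {t : ℝ} (ht : 0 < t) :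
    HasDerivAt (fun t => ∑' n : ℕ, (-Complex.I) ^ (n + 1) • dysonTerm H (n + 1) t)
      (∑' n : ℕ, (-Complex.I) ^ (n + 1) • (H t * dysonTerm H n t)) t := by
  obtain ⟨b, hb, hbound⟩ := exists_summable_bound hH (t + 1)
  have htmem : t ∈ Set.Ioo 0 (t + 1) := ⟨ht, by linarith⟩
  have hterm : ∀ n : ℕ, ∀ y ∈ Set.Ioo 0 (t + 1),
      HasDerivAt (fun t => (-Complex.I) ^ (n + 1) • dysonTerm H (n + 1) t)
        ((-Complex.I) ^ (n + 1) • (H y * dysonTerm H n y)) y :=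
    fun n y _ => (hasDerivAt_dysonTerm_succ hH n y).fun_const_smul ((-Complex.I) ^ (n + 1))
  have hle : ∀ n : ℕ, ∀ y ∈ Set.Ioo 0 (t + 1),
      ‖(-Complex.I) ^ (n + 1) • (H y * dysonTerm H n y)‖ ≤ b n := by
    intro n y hy
    rw [norm_smul, norm_pow, norm_neg, Complex.norm_I, one_pow, one_mul]
    exact (norm_mul_le _ _).trans (hbound n y (Set.Ioo_subset_Icc_self hy)).1
  have hsum := (summable_nat_add_iff 1).2 (summable_dysonTerm hH ht.le)
  exact hasDerivAt_tsum_of_isPreconnected hb isOpen_Ioo isPreconnected_Ioo hterm hle htmem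
    hsum htmem

end

/-- For continuous `H`, the time-ordered exponential solves the evolution equation
`dU/dt = −i H(t) U(t)` with `U(0) = 1`. -/
theorem chronoExp_solves_evolution {𝔄 : Type*} [NormedRing 𝔄] [NormedAlgebra ℂ 𝔄]
    [CompleteSpace 𝔄] (H : ℝ → 𝔄) (hH : Continuous H) :
    chronoExp H 0 = 1 ∧
      ∀ t : ℝ, 0 < t →
        HasDerivAt (chronoExp H) ((-Complex.I) • (H t * chronoExp H t)) t := by
  refine ⟨?_, fun t ht => ?_⟩
  · simp [chronoExp, openSimplex_succ_eq_empty]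
  have hsum := summable_dysonTerm hH ht.le
  have hderiv := hasDerivAt_tsum_dysonTerm hH ht
  have heq : chronoExp H =ᶠ[nhds t]
      fun t => 1 + ∑' n : ℕ, (-Complex.I) ^ (n + 1) • dysonTerm H (n + 1) t := by
    filter_upwards [lt_mem_nhds ht] with u hu using chronoExp_of_nonneg hH hu.le
  refine ((hderiv.const_add 1).congr_of_eventuallyEq heq).congr_deriv ?_
  have hU : chronoExp H t = ∑' n : ℕ, (-Complex.I) ^ n • dysonTerm H n t := by
    rw [chronoExp_of_nonneg hH ht.le, hsum.tsum_eq_zero_add]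
    simp [dysonTerm]
  rw [hU, ← hsum.tsum_mul_left, ← (hsum.mul_left (H t)).tsum_const_smul]
  refine tsum_congr fun n => ?_
  rw [pow_succ', mul_smul, mul_smul_comm]
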